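/- arXiv:2009.03889 — 4 statements merged into one kernel-verified Lean document; each statement's English description precedes it below -/
import Mathlib

section
/- Let n be a positive integer with n ≡ 2 (mod 3), and set M = (2n−1)/3. Then, as rational functions of q, Σ_{k=0}^{M} ((q;q^3)_k^3 / (q^3;q^3)_k^3) q^{3k} ≡ q^{M} · ((q^2;q^3)_M^2 / (q^3;q^3)_M^2) + [2n]^2 · ((q^2;q^3)_M^2 / ((q;q^3)_M (q^3;q^3)_M)) · Σ_{i=1}^{M} q^{3i-1} / [3i-1]^2 modulo Φ_n(q)^3. -/
open Finset

/-- The `q`-shifted factorial `(x; q)_k = (1-x)(1-xq)⋯(1-xq^{k-1})`. -/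
noncomputable def qPoch {K : Type*} [CommRing K] (x q : K) (k : ℕ) : K :=
  ∏ i ∈ Finset.range k, (1 - x * q ^ i)

/-- The `q`-integer `[m] = (1-q^m)/(1-q)` as a rational function of `q`. -/
noncomputable def qint (m : ℕ) : RatFunc ℚ :=
  (1 - RatFunc.X ^ m) / (1 - RatFunc.X)

/-- Congruence of rational functions modulo a polynomial: `A ≡ B (mod P)` means
`A - B = P * r / s` with `s` a nonzero polynomial coprime to `P`. -/
def ratCongr (A B : RatFunc ℚ) (P : Polynomial ℚ) : Prop :=
  ∃ r s : Polynomial ℚ, s ≠ 0 ∧ IsRelPrime s P ∧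
    A - B = algebraMap (Polynomial ℚ) (RatFunc ℚ) (P * r) /
            algebraMap (Polynomial ℚ) (RatFunc ℚ) s

section Saalschutz

variable {K : Type*} [Field K]

/-- The coefficient of `(A; p)_k (B; p)_k`, with `A B = E`, in the balanced `₃φ₂` series with
parameters `A`, `B`, `p ^ (-N)` over `p`, `E p ^ (-N)`. -/
noncomputable def saalCoeff (p E : K) (N k : ℕ) : K :=
  p ^ k * ∏ i ∈ range k,
    (p ^ N - p ^ i) / ((1 - p ^ (i + 1)) ^ 2 * (p ^ N - E * p ^ i))

/-- The product `(A; p)_k (B; p)_k` in terms of `s = A + B` and `E = A B`. -/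
noncomputable def pochPair (p E s : K) (k : ℕ) : K :=
  ∏ i ∈ range k, (1 - s * p ^ i + E * p ^ (2 * i))

theorem saalCoeff_self_succ (p E : K) (N : ℕ) : saalCoeff p E N (N + 1) = 0 := by
  simp [saalCoeff, prod_range_succ]

theorem saalCoeff_succ (p E : K) (N k : ℕ) :
    saalCoeff p E N (k + 1) = saalCoeff p E N k *
      (p * ((p ^ N - p ^ k) / ((1 - p ^ (k + 1)) ^ 2 * (p ^ N - E * p ^ k)))) := by
  simp only [saalCoeff, prod_range_succ]
  ring

theorem saalCoeff_succ_succ {p E : K} (hp : p ≠ 0) {N : ℕ} (k : ℕ) (hk : p ^ (k + 1) ≠ 1) :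
    saalCoeff p E (N + 1) (k + 1) = saalCoeff p E N k *
      (p * (p ^ (N + 1) - 1) / ((1 - p ^ (k + 1)) ^ 2 * (p ^ (N + 1) - E))) := by
  have hk' : (1 - p ^ (k + 1)) ≠ 0 := sub_ne_zero.mpr hk.symm
  simp only [saalCoeff, mul_comm ((1 - p ^ _) ^ 2), ← div_div, prod_div_distrib]
  rw [prod_range_succ (fun i => (1 - p ^ (i + 1)) ^ 2), ← prod_div_distrib,
    ← prod_div_distrib, prod_range_succ']
  have h : ∀ i ∈ range k, (p ^ (N + 1) - p ^ (i + 1)) / (p ^ (N + 1) - E * p ^ (i + 1)) =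
      (p ^ N - p ^ i) / (p ^ N - E * p ^ i) := by
    intro i _
    rw [← mul_div_mul_left (p ^ N - p ^ i) _ hp]
    congr 1 <;> ring
  rw [prod_congr rfl h]
  simp only [pow_zero, mul_one, div_eq_mul_inv, mul_inv]
  ring

theorem sum_saalCoeff_telescope {p E s : K} (hp : p ≠ 0) (hp1 : ∀ j, p ^ (j + 1) ≠ 1) {N : ℕ}
    (hE : ∀ i, p ^ N ≠ E * p ^ i) (hE' : p ^ (N + 1) ≠ E) (m : ℕ) :
    ∑ k ∈ range (m + 1), (saalCoeff p E (N + 1) k * pochPair p E s k -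
      (E - s * p ^ (N + 1) + p ^ (2 * (N + 1))) / ((1 - p ^ (N + 1)) * (E - p ^ (N + 1))) *
        (saalCoeff p E N k * pochPair p E s k)) =
      -p ^ (N + 1) / ((1 - p ^ (N + 1)) * (E - p ^ (N + 1))) * p⁻¹ ^ m *
        (saalCoeff p E N m * pochPair p E s (m + 1)) := by
  have h1 : 1 - p ^ (N + 1) ≠ 0 := sub_ne_zero.mpr (hp1 N).symm
  have h2 : E - p ^ (N + 1) ≠ 0 := sub_ne_zero.mpr hE'.symm
  have h2' : p ^ (N + 1) - E ≠ 0 := sub_ne_zero.mpr hE'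
  induction m with
  | zero =>
    simp only [saalCoeff, pochPair, zero_add, sum_range_one, prod_range_one, prod_range_zero]
    field_simp
    ring
  | succ m ih =>
    rw [sum_range_succ, ih, saalCoeff_succ_succ hp _ (hp1 m), saalCoeff_succ]
    have h3 : 1 - p ^ (m + 1) ≠ 0 := sub_ne_zero.mpr (hp1 m).symm
    have h4 : p ^ N - E * p ^ m ≠ 0 := sub_ne_zero.mpr (hE m)
    have hP : pochPair p E s (m + 1 + 1) = pochPair p E s (m + 1) *
      (1 - s * p ^ (m + 1) + E * p ^ (2 * (m + 1))) := prod_range_succ _ _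
    rw [hP]
    generalize pochPair p E s (m + 1) = w
    generalize saalCoeff p E N m = c
    have e : -p ^ (N + 1) / ((1 - p ^ (N + 1)) * (E - p ^ (N + 1))) * p⁻¹ ^ m =
      -p ^ (N + 1) * p / ((1 - p ^ (N + 1)) * (E - p ^ (N + 1))) * p⁻¹ ^ (m + 1) := by
      rw [pow_succ p⁻¹, mul_comm _ p⁻¹, ← mul_assoc]; field_simp
    have e2 : p * (p ^ (N + 1) - 1) / ((1 - p ^ (m + 1)) ^ 2 * (p ^ (N + 1) - E)) =
      p * (1 - p ^ (N + 1)) / ((1 - p ^ (m + 1)) ^ 2 * (E - p ^ (N + 1))) := by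
      rw [div_eq_div_iff (by positivity) (by positivity)]; ring
    rw [e, e2, inv_pow]
    have hpm : p ^ (m + 1) ≠ 0 := pow_ne_zero _ hp
    have hx : p ^ m = p ^ (m + 1) / p := by rw [pow_succ]; field_simp
    have hN : p ^ N = p ^ (N + 1) / p := by rw [pow_succ]; field_simp
    have h5 : p ^ (N + 1) - E * p ^ (m + 1) ≠ 0 := by
      rw [pow_succ, pow_succ, ← mul_assoc, ← sub_mul]; exact mul_ne_zero h4 hp
    have e3 : (p ^ N - p ^ m) / ((1 - p ^ (m + 1)) ^ 2 * (p ^ N - E * p ^ m)) =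
      (p ^ (N + 1) - p ^ (m + 1)) / ((1 - p ^ (m + 1)) ^ 2 * (p ^ (N + 1) - E * p ^ (m + 1))) := by
      rw [div_eq_div_iff (by positivity) (by positivity)]; ring
    rw [e3, mul_comm 2 (N + 1), mul_comm 2 (m + 1), pow_mul, pow_mul]
    clear e e2 e3 h4 hx hN hP ih
    generalize p ^ (m + 1) = x at *
    generalize p ^ (N + 1) = P at *
    field_simp
    ring

/-- The `q`-Pfaff–Saalschütz summation with one lower parameter equal to `p`. -/
theorem sum_saalCoeff {p E s : K} (hp : p ≠ 0) (hp1 : ∀ j, p ^ (j + 1) ≠ 1) {N : ℕ}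
    (hE : ∀ m ≤ N, ∀ i, p ^ m ≠ E * p ^ i) :
    ∑ k ∈ range (N + 1), saalCoeff p E N k * pochPair p E s k =
      ∏ j ∈ range N, (E - s * p ^ (j + 1) + p ^ (2 * (j + 1))) /
        ((1 - p ^ (j + 1)) * (E - p ^ (j + 1))) := by
  induction N with
  | zero => simp [saalCoeff, pochPair]
  | succ N ih =>
    have h := sum_saalCoeff_telescope (s := s) hp hp1 (hE N N.le_succ)
      (by simpa using hE (N + 1) le_rfl 0) (N + 1)
    rw [saalCoeff_self_succ, zero_mul, mul_zero, sum_sub_distrib, ← mul_sum, sub_eq_zero] at h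
    rw [h, sum_range_succ, saalCoeff_self_succ, zero_mul, add_zero,
      ih fun m hm => hE m (hm.trans N.le_succ), prod_range_succ, mul_comm]

end Saalschutz

section Evaluations

variable {K : Type*} [Field K] {q : K}

theorem pochPair_eq_qPoch_sq (p : K) (k : ℕ) :
    pochPair p (q ^ 2) (q * 2) k = qPoch q p k ^ 2 := by
  simp only [pochPair, qPoch, ← prod_pow]
  refine prod_congr rfl fun i _ => ?_
  ring

theorem sum_qPoch_pochPair (hq0 : q ≠ 0) (hq : Function.Injective (q ^ · : ℕ → K)) {M : ℕ} {Q : K}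
    (hQ : Q = q ^ (3 * M + 1)) :
    ∑ k ∈ range (M + 1), q ^ (3 * k) * (qPoch q (q ^ 3) k / qPoch (q ^ 3) (q ^ 3) k ^ 3) *
        pochPair (q ^ 3) (q ^ 2) (q * (Q + Q⁻¹)) k =
      q ^ M * (qPoch (q ^ 2) (q ^ 3) M ^ 2 / qPoch (q ^ 3) (q ^ 3) M ^ 2) := by
  have hne : ∀ {a b : ℕ}, a ≠ b → q ^ a ≠ q ^ b := fun h h' => h (hq h')
  have hQ0 : Q ≠ 0 := hQ ▸ pow_ne_zero _ hq0
  have h := sum_saalCoeff (s := q + q * Q) (E := q ^ 2 * Q) (pow_ne_zero 3 hq0) (N := M)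
    (fun j => by rw [← pow_mul, ← pow_zero q]; exact hne (by omega))
    (fun m hm i => by
      rw [hQ, ← pow_mul, ← pow_mul, ← pow_add, ← pow_add]; exact hne (by omega))
  refine Eq.trans (sum_congr rfl fun k _ => ?_) (h.trans ?_)
  · simp only [saalCoeff, pochPair, qPoch, pow_mul q 3 k, ← prod_pow, ← prod_div_distrib, mul_assoc,
      ← prod_mul_distrib]
    congr 1
    refine prod_congr rfl fun i _ => ?_
    have hM : (q ^ 3) ^ M = Q / q := by
      rw [hQ, ← pow_mul, pow_succ, mul_div_cancel_right₀ _ hq0]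
    have h1 : 1 - (q ^ 3) ^ (i + 1) ≠ 0 := by
      rw [← pow_mul, sub_ne_zero, ← pow_zero q]; exact hne (by omega)
    have h2 : (q ^ 3) ^ M - q ^ 2 * (Q * (q ^ 3) ^ i) = Q / q * (1 - (q ^ 3) ^ (i + 1)) := by
      rw [hM, pow_succ (q ^ 3) i]; field_simp
    have h3 : 1 - q ^ 3 * (q ^ 3) ^ i = 1 - (q ^ 3) ^ (i + 1) := by
      rw [pow_succ' (q ^ 3) i]
    rw [h2, hM, h3, mul_comm 2 i, pow_mul]
    generalize 1 - (q ^ 3) ^ (i + 1) = b at *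
    generalize (q ^ 3) ^ i = x
    field_simp
    ring
  · have hfac : ∀ j ∈ range M, (q ^ 2 * Q - (q + q * Q) * (q ^ 3) ^ (j + 1) +
        (q ^ 3) ^ (2 * (j + 1))) / ((1 - (q ^ 3) ^ (j + 1)) * (q ^ 2 * Q - (q ^ 3) ^ (j + 1))) =
        q * ((1 - q ^ 2 * (q ^ 3) ^ j) / (1 - q ^ 3 * (q ^ 3) ^ j)) *
        ((1 - q ^ 2 * (q ^ 3) ^ (M - 1 - j)) / (1 - q ^ 3 * (q ^ 3) ^ (M - 1 - j))) := by
      intro j hj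
      obtain ⟨d, rfl⟩ : ∃ d, M = d + 1 + j := ⟨M - 1 - j, by have := mem_range.mp hj; omega⟩
      have e : d + 1 + j - 1 - j = d := by omega
      have h1 : 1 - q ^ 3 * (q ^ 3) ^ j ≠ 0 := by
        rw [← pow_mul, ← pow_add, sub_ne_zero, ← pow_zero q]; exact hne (by omega)
      have h2 : 1 - q ^ 3 * (q ^ 3) ^ d ≠ 0 := by
        rw [← pow_mul, ← pow_add, sub_ne_zero, ← pow_zero q]; exact hne (by omega)
      have hQ' : Q = (q ^ 3) ^ d * q ^ 4 * (q ^ 3) ^ j := by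
        rw [hQ, ← pow_mul, ← pow_mul, ← pow_add, ← pow_add]; congr 1; ring
      have h3 : (1 - (q ^ 3) ^ (j + 1)) * (q ^ 2 * Q - (q ^ 3) ^ (j + 1)) =
          -(q ^ 3 * (q ^ 3) ^ j) * (1 - q ^ 3 * (q ^ 3) ^ j) * (1 - q ^ 3 * (q ^ 3) ^ d) := by
        rw [hQ']; ring
      have h4 : q ^ 2 * Q - (q + q * Q) * (q ^ 3) ^ (j + 1) + (q ^ 3) ^ (2 * (j + 1)) =
          -(q ^ 3 * (q ^ 3) ^ j) *
            (q * (1 - q ^ 2 * (q ^ 3) ^ j) * (1 - q ^ 2 * (q ^ 3) ^ d)) := by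
        rw [hQ']; ring
      have h5 : -(q ^ 3 * (q ^ 3) ^ j) ≠ 0 := neg_ne_zero.mpr (by positivity)
      rw [e, h3, h4, mul_assoc (-_), mul_div_mul_left _ _ h5]
      field_simp
    rw [prod_congr rfl hfac, prod_mul_distrib, prod_mul_distrib,
      prod_range_reflect (fun j => (1 - q ^ 2 * (q ^ 3) ^ j) / (1 - q ^ 3 * (q ^ 3) ^ j)) M]
    simp only [prod_const, card_range, prod_div_distrib, qPoch]
    ring

theorem sum_saalCoeff_sq (hq0 : q ≠ 0) (hq : Function.Injective (q ^ · : ℕ → K)) (M : ℕ) (t : K) :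
    ∑ k ∈ range (M + 1), saalCoeff (q ^ 3) (q ^ 2) M k * pochPair (q ^ 3) (q ^ 2) (q * t) k =
      (∏ j ∈ range M, (1 - t * q ^ (3 * j + 2) + (q ^ (3 * j + 2)) ^ 2)) /
        (qPoch q (q ^ 3) M * qPoch (q ^ 3) (q ^ 3) M) := by
  have hne : ∀ {a b : ℕ}, a ≠ b → q ^ a ≠ q ^ b := fun h h' => h (hq h')
  rw [sum_saalCoeff (pow_ne_zero 3 hq0)
    (fun j => by rw [← pow_mul, ← pow_zero q]; exact hne (by omega))
    (fun m _ i => by rw [← pow_mul, ← pow_mul, ← pow_add]; exact hne (by omega))]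
  simp only [qPoch, ← prod_mul_distrib, ← prod_div_distrib]
  refine prod_congr rfl fun j _ => ?_
  rw [← mul_div_mul_left _ ((1 - q * (q ^ 3) ^ j) * _) (pow_ne_zero 2 hq0)]
  congr 1 <;> ring_nf

end Evaluations

section Localization

open Polynomial

/-- `P ^ k` divides `x` in the localization of `ℚ[X]` at the elements coprime to `P`. -/
def PowDvdLoc (P : ℚ[X]) (k : ℕ) (x : RatFunc ℚ) : Prop :=
  ∃ r s : ℚ[X], s ≠ 0 ∧ IsCoprime s P ∧
    x = algebraMap ℚ[X] (RatFunc ℚ) (P ^ k * r) / algebraMap ℚ[X] (RatFunc ℚ) s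

namespace PowDvdLoc

variable {P : ℚ[X]} {k l : ℕ} {x y : RatFunc ℚ}

theorem of_poly (r : ℚ[X]) : PowDvdLoc P k (algebraMap _ _ (P ^ k * r)) :=
  ⟨r, 1, one_ne_zero, isCoprime_one_left, by simp⟩

theorem zero : PowDvdLoc P k 0 := by simpa using of_poly (P := P) (k := k) 0

theorem one : PowDvdLoc P 0 1 := by simpa using of_poly (P := P) (k := 0) 1

theorem X : PowDvdLoc P 0 RatFunc.X := by
  simpa [RatFunc.algebraMap_X] using of_poly (P := P) (k := 0) Polynomial.X

theorem inv_poly {s : ℚ[X]} (hs : s ≠ 0) (h : IsCoprime s P) :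
    PowDvdLoc P 0 (algebraMap ℚ[X] (RatFunc ℚ) s)⁻¹ :=
  ⟨1, s, hs, h, by simp⟩

theorem add (hx : PowDvdLoc P k x) (hy : PowDvdLoc P k y) : PowDvdLoc P k (x + y) := by
  obtain ⟨r, s, hs, hc, rfl⟩ := hx
  obtain ⟨r', s', hs', hc', rfl⟩ := hy
  refine ⟨r * s' + r' * s, s * s', mul_ne_zero hs hs', hc.mul_left hc', ?_⟩
  have h1 := RatFunc.algebraMap_ne_zero hs
  have h2 := RatFunc.algebraMap_ne_zero hs'
  rw [div_add_div _ _ h1 h2]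
  simp only [map_mul, map_add]
  ring

theorem mul (hx : PowDvdLoc P k x) (hy : PowDvdLoc P l y) : PowDvdLoc P (k + l) (x * y) := by
  obtain ⟨r, s, hs, hc, rfl⟩ := hx
  obtain ⟨r', s', hs', hc', rfl⟩ := hy
  refine ⟨r * r', s * s', mul_ne_zero hs hs', hc.mul_left hc', ?_⟩
  rw [div_mul_div_comm, ← map_mul, ← map_mul]
  congr 2
  ring

theorem mul_right (hx : PowDvdLoc P k x) (hy : PowDvdLoc P 0 y) : PowDvdLoc P k (x * y) := by
  simpa only [add_zero] using hx.mul hy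

theorem mul_left (hx : PowDvdLoc P 0 x) (hy : PowDvdLoc P k y) : PowDvdLoc P k (x * y) := by
  simpa only [zero_add] using hx.mul hy

theorem neg (hx : PowDvdLoc P k x) : PowDvdLoc P k (-x) := by
  obtain ⟨r, s, hs, hc, rfl⟩ := hx
  exact ⟨-r, s, hs, hc, by rw [mul_neg, map_neg, neg_div]⟩

theorem sub (hx : PowDvdLoc P k x) (hy : PowDvdLoc P k y) : PowDvdLoc P k (x - y) :=
  sub_eq_add_neg x y ▸ hx.add hy.neg

theorem mono (hx : PowDvdLoc P k x) (h : l ≤ k) : PowDvdLoc P l x := by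
  obtain ⟨r, s, hs, hc, rfl⟩ := hx
  refine ⟨P ^ (k - l) * r, s, hs, hc, ?_⟩
  rw [← mul_assoc, ← pow_add, Nat.add_sub_cancel' h]

theorem pow (hx : PowDvdLoc P k x) (m : ℕ) : PowDvdLoc P (k * m) (x ^ m) := by
  induction m with
  | zero => simpa using one
  | succ m ih => rw [pow_succ, mul_add, mul_one]; exact ih.mul hx

theorem sum {ι : Type*} {s : Finset ι} {f : ι → RatFunc ℚ} (h : ∀ i ∈ s, PowDvdLoc P k (f i)) :
    PowDvdLoc P k (∑ i ∈ s, f i) :=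
  sum_induction f (PowDvdLoc P k) (fun _ _ => add) zero h

theorem prod {ι : Type*} {s : Finset ι} {f : ι → RatFunc ℚ} (h : ∀ i ∈ s, PowDvdLoc P 0 (f i)) :
    PowDvdLoc P 0 (∏ i ∈ s, f i) :=
  prod_induction f (PowDvdLoc P 0) (fun _ _ => mul_right) one h

theorem prod_sub_prod {m : ℕ} {f g : ℕ → RatFunc ℚ} (hf : ∀ i < m, PowDvdLoc P 0 (f i))
    (hg : ∀ i < m, PowDvdLoc P 0 (g i)) (h : ∀ i < m, PowDvdLoc P k (f i - g i)) :
    PowDvdLoc P k (∏ i ∈ range m, f i - ∏ i ∈ range m, g i) := by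
  induction m with
  | zero => simpa using zero
  | succ m ih =>
    rw [prod_range_succ, prod_range_succ, show ∀ a b c d : RatFunc ℚ,
      a * b - c * d = (a - c) * b + c * (b - d) by intros; ring]
    refine ((ih (fun i hi => hf i (by omega)) (fun i hi => hg i (by omega))
      fun i hi => h i (by omega)).mul_right (hf m (by omega))).add (mul_left (prod fun i hi => ?_)
        (h m (by omega)))
    exact hg i (by have := mem_range.mp hi; omega)

/-- First-order expansion of `∏ (a i - δ u i)` in `δ`. -/
theorem prod_sub_prod_sub {m : ℕ} {a u : ℕ → RatFunc ℚ} {δ : RatFunc ℚ} (hδ : PowDvdLoc P k δ)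
    (ha0 : ∀ i, a i ≠ 0) (ha : ∀ i, PowDvdLoc P 0 (a i)) (hu : ∀ i, PowDvdLoc P 0 (u i)) :
    PowDvdLoc P 0 ((∏ i ∈ range m, a i) * ∑ i ∈ range m, u i / a i) ∧
    PowDvdLoc P (k + k) (∏ i ∈ range m, a i - ∏ i ∈ range m, (a i - δ * u i) -
      δ * ((∏ i ∈ range m, a i) * ∑ i ∈ range m, u i / a i)) := by
  induction m with
  | zero => simpa using ⟨zero, zero⟩
  | succ m ih =>
    have hW : (∏ i ∈ range (m + 1), a i) * ∑ i ∈ range (m + 1), u i / a i =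
        ((∏ i ∈ range m, a i) * ∑ i ∈ range m, u i / a i) * a m +
          (∏ i ∈ range m, a i) * u m := by
      have := ha0 m
      rw [prod_range_succ, sum_range_succ]
      field_simp
    have hA : PowDvdLoc P 0 (∏ i ∈ range m, a i) := prod fun i _ => ha i
    rw [hW, prod_range_succ, prod_range_succ]
    obtain ⟨h1, h2⟩ := ih
    generalize (∏ i ∈ range m, a i) * ∑ i ∈ range m, u i / a i = W at *
    generalize ∏ i ∈ range m, a i = A at *
    generalize ∏ i ∈ range m, (a i - δ * u i) = B at *
    refine ⟨(h1.mul_right (ha m)).add (hA.mul_right (hu m)), ?_⟩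
    have hδ0 : PowDvdLoc P 0 δ := hδ.mono (Nat.zero_le _)
    have e : A * a m - B * (a m - δ * u m) - δ * (W * a m + A * u m) =
        (A - B - δ * W) * (a m - δ * u m) - δ * δ * (W * u m) := by ring
    rw [e]
    exact (h2.mul_right ((ha m).sub (hδ0.mul_right (hu m)))).sub
      ((hδ.mul hδ).mul_right (h1.mul_right (hu m)))

theorem ratCongr {A B : RatFunc ℚ} (h : PowDvdLoc P k (A - B)) : ratCongr A B (P ^ k) := by
  obtain ⟨r, s, hs, hc, e⟩ := h
  exact ⟨r, s, hs, hc.pow_right.isRelPrime, e⟩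

theorem one_sub_X_pow {n m : ℕ} (h : n ∣ m) :
    PowDvdLoc (cyclotomic n ℚ) 1 (1 - RatFunc.X ^ m) := by
  obtain ⟨c, rfl⟩ := h
  obtain ⟨r, hr⟩ := (cyclotomic.dvd_X_pow_sub_one n ℚ).trans
    (pow_one_sub_dvd_pow_mul_sub_one _ n c)
  have := (of_poly (P := cyclotomic n ℚ) (k := 1) r).neg
  rw [pow_one, ← hr] at this
  simpa [RatFunc.algebraMap_X] using this

theorem inv_one_sub_X_pow {n m : ℕ} (hn : 0 < n) (h : ¬ n ∣ m) :
    PowDvdLoc (cyclotomic n ℚ) 0 (1 - RatFunc.X ^ m)⁻¹ := by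
  have hd : ¬ cyclotomic n ℚ ∣ 1 - Polynomial.X ^ m := by
    intro hd
    have h1 := map_dvd (aeval (Complex.exp (2 * Real.pi * Complex.I / n))) hd
    have hζ := Complex.isPrimitiveRoot_exp n hn.ne'
    have h0 : aeval (Complex.exp (2 * Real.pi * Complex.I / n)) (cyclotomic n ℚ) = 0 := by
      rw [aeval_def, eval₂_eq_eval_map, map_cyclotomic]
      exact hζ.isRoot_cyclotomic hn
    rw [h0, zero_dvd_iff] at h1
    simp only [map_sub, map_one, map_pow, aeval_X] at h1
    exact h (hζ.dvd_of_pow_eq_one m (sub_eq_zero.mp h1).symm)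
  have := inv_poly (P := cyclotomic n ℚ) (s := 1 - Polynomial.X ^ m)
    (fun h0 => hd (h0 ▸ dvd_zero _))
    (((cyclotomic.irreducible_rat hn).coprime_iff_not_dvd.mpr hd).symm)
  simpa [RatFunc.algebraMap_X] using this

theorem inv_X {n : ℕ} (hn : 0 < n) : PowDvdLoc (cyclotomic n ℚ) 0 (RatFunc.X : RatFunc ℚ)⁻¹ := by
  have hc : IsCoprime (Polynomial.X : ℚ[X]) (cyclotomic n ℚ) := by
    obtain ⟨r, hr⟩ := cyclotomic.dvd_X_pow_sub_one n ℚ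
    refine ⟨Polynomial.X ^ (n - 1), -r, ?_⟩
    rw [← pow_succ, Nat.sub_add_cancel hn, neg_mul, mul_comm r, ← hr]
    ring
  simpa [RatFunc.algebraMap_X] using inv_poly Polynomial.X_ne_zero hc

end PowDvdLoc

theorem RatFunc.X_pow_injective :
    Function.Injective ((RatFunc.X : RatFunc ℚ) ^ · : ℕ → RatFunc ℚ) := by
  intro a b h
  simp only [← RatFunc.algebraMap_X, ← map_pow] at h
  simpa using congrArg natDegree (RatFunc.algebraMap_injective ℚ h)

end Localization

section Coefficients

open Polynomial

variable {n M : ℕ}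

theorem X_pow_sub_inv_mem (hn : 0 < n) {m l : ℕ} (hm : m ≤ l) (h : ¬ n ∣ l - m) :
    PowDvdLoc (cyclotomic n ℚ) 0 ((RatFunc.X : RatFunc ℚ) ^ m - RatFunc.X ^ l)⁻¹ := by
  have e : (RatFunc.X : RatFunc ℚ) ^ m - RatFunc.X ^ l =
      RatFunc.X ^ m * (1 - RatFunc.X ^ (l - m)) := by
    rw [mul_sub, mul_one, ← pow_add, Nat.add_sub_cancel' hm]
  rw [e, mul_inv, ← inv_pow]
  refine PowDvdLoc.mul_right ?_ (PowDvdLoc.inv_one_sub_X_pow hn h)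
  simpa using (PowDvdLoc.inv_X hn).pow m

theorem PowDvdLoc.X_pow {P : ℚ[X]} (m : ℕ) : PowDvdLoc P 0 (RatFunc.X ^ m) := by
  simpa using PowDvdLoc.X.pow m

theorem not_dvd_three_mul (hmod : n % 3 = 2) (hM : 3 * M + 1 = 2 * n) {i : ℕ} (hi : i < M) :
    ¬ n ∣ 3 * (i + 1) := by
  intro h
  have hc : Nat.Coprime n 3 := by
    rw [Nat.coprime_comm, Nat.Prime.coprime_iff_not_dvd Nat.prime_three]; omega
  have := Nat.le_of_dvd (Nat.succ_pos i) (hc.dvd_of_dvd_mul_left h)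
  omega

theorem qPoch_div_sub_saalCoeff (hn : 0 < n) (hmod : n % 3 = 2) (hM : 3 * M + 1 = 2 * n) {k : ℕ}
    (hk : k ≤ M) :
    PowDvdLoc (cyclotomic n ℚ) 1 (RatFunc.X ^ (3 * k) *
      (qPoch RatFunc.X (RatFunc.X ^ 3) k / qPoch (RatFunc.X ^ 3) (RatFunc.X ^ 3) k ^ 3) -
        saalCoeff (RatFunc.X ^ 3) (RatFunc.X ^ 2) M k) := by
  have hX : (RatFunc.X : RatFunc ℚ) ≠ 0 := RatFunc.X_ne_zero
  have hne : ∀ {a b : ℕ}, a ≠ b → (RatFunc.X : RatFunc ℚ) ^ a - RatFunc.X ^ b ≠ 0 :=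
    fun h h' => h (RatFunc.X_pow_injective (sub_eq_zero.mp h'))
  have key : ∀ i < k,
      PowDvdLoc (cyclotomic n ℚ) 0 (((RatFunc.X : RatFunc ℚ) ^ 0 - RatFunc.X ^ (3 * (i + 1)))⁻¹) ∧
      PowDvdLoc (cyclotomic n ℚ) 0
        (((RatFunc.X : RatFunc ℚ) ^ (3 * (i + 1)) - RatFunc.X ^ (2 * n))⁻¹) := by
    intro i hi
    have h := not_dvd_three_mul hmod hM (hi.trans_le hk)
    refine ⟨X_pow_sub_inv_mem hn (Nat.zero_le _) (by simpa using h),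
      X_pow_sub_inv_mem hn (by omega) fun h' => h ?_⟩
    exact (Nat.dvd_sub_iff_right (by omega) (dvd_mul_left n 2)).mp h'
  have hf : ∀ i : ℕ, (1 - RatFunc.X * (RatFunc.X ^ 3) ^ i) /
      (1 - RatFunc.X ^ 3 * (RatFunc.X ^ 3) ^ i) ^ 3 =
      ((1 : RatFunc ℚ) - RatFunc.X ^ (3 * i + 1)) *
        (((RatFunc.X : RatFunc ℚ) ^ 0 - RatFunc.X ^ (3 * (i + 1)))⁻¹) ^ 3 := by
    intro i
    rw [inv_pow, ← div_eq_mul_inv]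
    ring_nf
  have hg : ∀ i : ℕ, ((RatFunc.X ^ 3) ^ M - (RatFunc.X ^ 3) ^ i) /
      ((1 - (RatFunc.X ^ 3) ^ (i + 1)) ^ 2 *
        ((RatFunc.X ^ 3) ^ M - RatFunc.X ^ 2 * (RatFunc.X ^ 3) ^ i)) =
      ((RatFunc.X : RatFunc ℚ) ^ (3 * i + 1) - RatFunc.X ^ (2 * n)) *
        (((RatFunc.X : RatFunc ℚ) ^ 0 - RatFunc.X ^ (3 * (i + 1)))⁻¹) ^ 2 *
        ((RatFunc.X : RatFunc ℚ) ^ (3 * (i + 1)) - RatFunc.X ^ (2 * n))⁻¹ := by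
    intro i
    rw [inv_pow, ← div_eq_mul_inv, ← div_eq_mul_inv, div_div, ← hM,
      ← mul_div_mul_left ((RatFunc.X ^ 3) ^ M - _) _ (neg_ne_zero.mpr hX)]
    congr 1 <;> ring
  rw [saalCoeff, ← pow_mul, ← mul_sub]
  refine PowDvdLoc.mul_left (PowDvdLoc.X_pow _) ?_
  simp only [qPoch]
  rw [← prod_pow, ← prod_div_distrib]
  refine PowDvdLoc.prod_sub_prod (fun i hi => ?_) (fun i hi => ?_) (fun i hi => ?_)
  · rw [hf]
    exact (PowDvdLoc.one.sub (.X_pow _)).mul_right ((key i hi).1.pow 3)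
  · rw [hg]
    exact (((PowDvdLoc.X_pow _).sub (.X_pow _)).mul_right ((key i hi).1.pow 2)).mul_right
      (key i hi).2
  · have e : ∀ a b Q : RatFunc ℚ, 1 - b ≠ 0 → b - Q ≠ 0 →
        (1 - a) * (1 - b)⁻¹ ^ 3 - (a - Q) * (1 - b)⁻¹ ^ 2 * (b - Q)⁻¹ =
        (1 - Q) * ((b - a) * (1 - b)⁻¹ ^ 3 * (b - Q)⁻¹) := by
      intro a b Q h1 h2
      field_simp
      ring
    have h := not_dvd_three_mul hmod hM (hi.trans_le hk)
    have h1 : (1 : RatFunc ℚ) - RatFunc.X ^ (3 * (i + 1)) ≠ 0 := by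
      rw [← pow_zero RatFunc.X]; exact hne (by omega)
    have h2 : (RatFunc.X : RatFunc ℚ) ^ (3 * (i + 1)) - RatFunc.X ^ (2 * n) ≠ 0 :=
      hne fun h' => h (h' ▸ dvd_mul_left n 2)
    rw [hf, hg, pow_zero, e _ _ _ h1 h2, ← pow_zero RatFunc.X]
    refine PowDvdLoc.mul_right ?_ ((((PowDvdLoc.X_pow _).sub (.X_pow _)).mul_right
      ((key i hi).1.pow 3)).mul_right (key i hi).2)
    rw [pow_zero]
    exact PowDvdLoc.one_sub_X_pow (dvd_mul_left n 2)

theorem inv_qPoch_mem {x : ℕ} (hn : 0 < n) (h : ∀ i < M, ¬ n ∣ x + 3 * i) :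
    PowDvdLoc (cyclotomic n ℚ) 0 (qPoch ((RatFunc.X : RatFunc ℚ) ^ x) (RatFunc.X ^ 3) M)⁻¹ := by
  rw [qPoch, ← prod_inv_distrib]
  refine PowDvdLoc.prod fun i hi => ?_
  rw [← pow_mul, ← pow_add]
  exact PowDvdLoc.inv_one_sub_X_pow hn (h i (mem_range.mp hi))

theorem pochPair_sub_pochPair {P : ℚ[X]} {k m : ℕ} {s s' : RatFunc ℚ} (hs : PowDvdLoc P 0 s)
    (h : PowDvdLoc P m (s' - s)) :
    PowDvdLoc P m (pochPair (RatFunc.X ^ 3) (RatFunc.X ^ 2) s k -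
      pochPair (RatFunc.X ^ 3) (RatFunc.X ^ 2) s' k) := by
  have hs' : PowDvdLoc P 0 s' := by simpa using (h.mono (Nat.zero_le _)).add hs
  have hmem : ∀ {s : RatFunc ℚ} (i : ℕ), PowDvdLoc P 0 s → PowDvdLoc P 0
      (1 - s * (RatFunc.X ^ 3) ^ i + RatFunc.X ^ 2 * (RatFunc.X ^ 3) ^ (2 * i)) := by
    intro s i hs
    simp only [← pow_mul]
    exact (PowDvdLoc.one.sub (hs.mul_right (.X_pow _))).add
      ((PowDvdLoc.X_pow _).mul_right (.X_pow _))
  refine PowDvdLoc.prod_sub_prod (fun i _ => hmem i hs) (fun i _ => hmem i hs') fun i _ => ?_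
  have e : ∀ x y : RatFunc ℚ, 1 - s * x + y - (1 - s' * x + y) = (s' - s) * x := by
    intros; ring
  rw [e, ← pow_mul]
  exact h.mul_right (.X_pow _)

end Coefficients

theorem stmt13 (n M : ℕ) (hn : 0 < n) (hmod : n % 3 = 2) (hM : M = (2 * n - 1) / 3) :
    ratCongr
      (∑ k ∈ Finset.range (M + 1),
        qPoch RatFunc.X (RatFunc.X ^ 3) k ^ 3 /
          qPoch (RatFunc.X ^ 3) (RatFunc.X ^ 3) k ^ 3 * RatFunc.X ^ (3 * k))
      (RatFunc.X ^ M *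
          (qPoch (RatFunc.X ^ 2) (RatFunc.X ^ 3) M ^ 2 /
            qPoch (RatFunc.X ^ 3) (RatFunc.X ^ 3) M ^ 2) +
        qint (2 * n) ^ 2 *
          (qPoch (RatFunc.X ^ 2) (RatFunc.X ^ 3) M ^ 2 /
            (qPoch RatFunc.X (RatFunc.X ^ 3) M *
              qPoch (RatFunc.X ^ 3) (RatFunc.X ^ 3) M)) *
          ∑ i ∈ Finset.Icc 1 M, RatFunc.X ^ (3 * i - 1) / qint (3 * i - 1) ^ 2)
      ((Polynomial.cyclotomic n ℚ) ^ 3) := by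
  have hM' : 3 * M + 1 = 2 * n := by omega
  have hX : (RatFunc.X : RatFunc ℚ) ≠ 0 := RatFunc.X_ne_zero
  have hne : ∀ {m : ℕ}, 0 < m → (1 : RatFunc ℚ) - RatFunc.X ^ m ≠ 0 := fun {m} h h' => by
    rw [sub_eq_zero, ← pow_zero RatFunc.X] at h'
    exact h.ne (RatFunc.X_pow_injective h')
  set q : RatFunc ℚ := RatFunc.X with hq
  set Q := q ^ (2 * n) with hQ
  have hQ0 : Q ≠ 0 := pow_ne_zero _ hX
  set Φ := Polynomial.cyclotomic n ℚ
  set c : ℕ → RatFunc ℚ := fun k => q ^ (3 * k) * (qPoch q (q ^ 3) k / qPoch (q ^ 3) (q ^ 3) k ^ 3)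
  set A := ∏ i ∈ range M, (1 - q ^ (3 * i + 2)) ^ 2 with hA
  set W := A * ∑ i ∈ range M, q ^ (3 * i + 2) / (1 - q ^ (3 * i + 2)) ^ 2 with hW
  set D := qPoch q (q ^ 3) M * qPoch (q ^ 3) (q ^ 3) M
  have hQmem : PowDvdLoc Φ 1 (1 - Q) := PowDvdLoc.one_sub_X_pow (dvd_mul_left n 2)
  have hQinv : PowDvdLoc Φ 0 Q⁻¹ := by
    simpa [hQ, inv_pow] using (PowDvdLoc.inv_X hn).pow (2 * n)
  have hδ : PowDvdLoc Φ 2 (Q + Q⁻¹ - 2) := by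
    have e : Q + Q⁻¹ - 2 = (1 - Q) ^ 2 * Q⁻¹ := by field_simp; ring
    rw [e]
    exact (hQmem.pow 2).mul_right hQinv
  have hDinv : PowDvdLoc Φ 0 D⁻¹ := by
    rw [mul_inv]
    refine PowDvdLoc.mul_right ?_ (inv_qPoch_mem hn fun i hi => ?_)
    · have := inv_qPoch_mem (n := n) (M := M) (x := 1) hn fun i hi ⟨d, hd⟩ => ?_
      · simpa using this
      · have hd2 : d < 2 := by
          by_contra! h
          have := Nat.mul_le_mul_left n h
          omega
        interval_cases d <;> omega
    · have := not_dvd_three_mul hmod hM' hi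
      rwa [mul_add, mul_one, add_comm] at this
  obtain ⟨hW0, hW4⟩ := PowDvdLoc.prod_sub_prod_sub (m := M) hδ
    (a := fun i => (1 - q ^ (3 * i + 2)) ^ 2) (u := fun i => q ^ (3 * i + 2))
    (fun i => pow_ne_zero 2 (hne (by omega)))
    (fun i => (PowDvdLoc.one.sub (.X_pow _)).pow 2) (fun i => .X_pow _)
  rw [← hA, ← hW] at hW0 hW4
  have hlhs : ∀ k, qPoch q (q ^ 3) k ^ 3 / qPoch (q ^ 3) (q ^ 3) k ^ 3 * q ^ (3 * k) =
      c k * pochPair (q ^ 3) (q ^ 2) (q * 2) k := by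
    intro k
    rw [pochPair_eq_qPoch_sq]
    ring
  have hA' : qPoch (q ^ 2) (q ^ 3) M ^ 2 = A := by
    rw [hA, qPoch, ← prod_pow]
    refine prod_congr rfl fun i _ => ?_
    ring
  have hrhs : qint (2 * n) ^ 2 * (A / D) * ∑ i ∈ Icc 1 M, q ^ (3 * i - 1) / qint (3 * i - 1) ^ 2 =
      (1 - Q) ^ 2 * (W * D⁻¹) := by
    have h1 : 1 - q ≠ 0 := by simpa using hne one_pos
    have hs : ∑ i ∈ Icc 1 M, q ^ (3 * i - 1) / qint (3 * i - 1) ^ 2 =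
        (1 - q) ^ 2 * ∑ i ∈ range M, q ^ (3 * i + 2) / (1 - q ^ (3 * i + 2)) ^ 2 := by
      rw [mul_sum, ← Ico_add_one_right_eq_Icc, sum_Ico_eq_sum_range, Nat.add_sub_cancel]
      refine sum_congr rfl fun i _ => ?_
      rw [show 3 * (1 + i) - 1 = 3 * i + 2 by omega, qint, ← hq, div_pow, div_div_eq_mul_div]
      ring
    rw [hs, hW, qint, ← hq]
    field_simp
    ring
  set B := ∏ i ∈ range M, ((1 - q ^ (3 * i + 2)) ^ 2 - (Q + Q⁻¹ - 2) * q ^ (3 * i + 2)) with hB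
  have hS : ∑ k ∈ range (M + 1), c k * pochPair (q ^ 3) (q ^ 2) (q * (Q + Q⁻¹)) k =
      q ^ M * (qPoch (q ^ 2) (q ^ 3) M ^ 2 / qPoch (q ^ 3) (q ^ 3) M ^ 2) :=
    sum_qPoch_pochPair hX RatFunc.X_pow_injective (by rw [hM'])
  have h2 : ∑ k ∈ range (M + 1), saalCoeff (q ^ 3) (q ^ 2) M k *
      pochPair (q ^ 3) (q ^ 2) (q * 2) k = A / D := by
    rw [sum_saalCoeff_sq hX RatFunc.X_pow_injective, hA]
    congr 1
    exact prod_congr rfl fun i _ => by ring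
  have ht : ∑ k ∈ range (M + 1), saalCoeff (q ^ 3) (q ^ 2) M k *
      pochPair (q ^ 3) (q ^ 2) (q * (Q + Q⁻¹)) k = B / D := by
    rw [sum_saalCoeff_sq hX RatFunc.X_pow_injective, hB]
    congr 1
    exact prod_congr rfl fun i _ => by ring
  have hcross : PowDvdLoc Φ 3 (∑ k ∈ range (M + 1), (c k - saalCoeff (q ^ 3) (q ^ 2) M k) *
      (pochPair (q ^ 3) (q ^ 2) (q * 2) k - pochPair (q ^ 3) (q ^ 2) (q * (Q + Q⁻¹)) k)) := by
    refine PowDvdLoc.sum fun k hk => ?_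
    have h1 : PowDvdLoc Φ 1 (c k - saalCoeff (q ^ 3) (q ^ 2) M k) :=
      qPoch_div_sub_saalCoeff hn hmod hM' (mem_range_succ_iff.mp hk)
    have h2 : PowDvdLoc Φ 2 (pochPair (q ^ 3) (q ^ 2) (q * 2) k -
        pochPair (q ^ 3) (q ^ 2) (q * (Q + Q⁻¹)) k) := by
      refine pochPair_sub_pochPair ?_ ?_
      · rw [mul_two]; exact PowDvdLoc.X.add PowDvdLoc.X
      · rw [← mul_sub]; exact PowDvdLoc.X.mul_left hδ
    simpa only [Nat.reduceAdd] using h1.mul h2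
  simp only [sub_mul, mul_sub, sum_sub_distrib] at hcross
  rw [h2, ht] at hcross
  have hcube : PowDvdLoc Φ 3 ((1 - Q) ^ 3 * (Q⁻¹ * (W * D⁻¹))) :=
    (hQmem.pow 3).mul_right (hQinv.mul_right (hW0.mul_right hDinv))
  have hsum := (hcross.add ((hW4.mono (by norm_num : 3 ≤ 2 + 2)).mul_right hDinv)).add hcube
  apply PowDvdLoc.ratCongr
  rw [← hS, hA', hrhs, sum_congr rfl fun k _ => hlhs k]
  generalize ∑ k ∈ range (M + 1), c k * pochPair (q ^ 3) (q ^ 2) (q * 2) k = S at *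
  generalize ∑ k ∈ range (M + 1), c k * pochPair (q ^ 3) (q ^ 2) (q * (Q + Q⁻¹)) k = T at *
  clear_value W A B D Q
  convert hsum using 1
  field_simp
  ring
end

section
/- Let n be a positive integer with n ≡ 2 (mod 3), and set M = (2n−1)/3. Then, as rational functions of q, (q;q^3)_M ≡ −q^{−M} (q^3;q^3)_M modulo Φ_n(q). -/
open Finset

theorem qPoch_map {K L : Type*} [CommRing K] [CommRing L] (f : K →+* L) (x q : K) (k : ℕ) :
    f (qPoch x q k) = qPoch (f x) (f q) k := by
  simp [qPoch, map_prod]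

theorem pow_mul_qPoch_eq_neg_qPoch_of_pow_eq_one {R : Type*} [CommRing R] {x : R} {n M : ℕ}
    (hx : x ^ n = 1) (hM : 3 * M + 1 = 2 * n) :
    x ^ M * qPoch x (x ^ 3) M = -qPoch (x ^ 3) (x ^ 3) M := by
  obtain ⟨k, rfl⟩ : ∃ k, M = 2 * k + 1 := ⟨M / 2, by omega⟩
  obtain rfl : n = 3 * k + 2 := by omega
  have hprod : ∏ i ∈ range (2 * k + 1), x ^ (3 * (i + 1)) = x ^ (2 * k + 1) := by
    have hsum : ∑ i ∈ range (2 * k + 1), 3 * (i + 1) =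
        (3 * k + 2) * (2 * k + 1) + (2 * k + 1) := by
      have h := Finset.sum_range_id_mul_two (2 * k + 1)
      simp only [Nat.add_sub_cancel] at h
      rw [← Finset.mul_sum, Finset.sum_add_distrib]
      simp only [Finset.sum_const, Finset.card_range, smul_eq_mul, mul_one]
      nlinarith
    rw [Finset.prod_pow_eq_pow_sum, hsum, pow_add, pow_mul, hx, one_pow, one_mul]
  have hneg : (-1 : R) = ∏ _i ∈ range (2 * k + 1), (-1 : R) := by
    simp [pow_succ]
  rw [← hprod, qPoch, qPoch, ← Finset.prod_range_reflect (fun i => 1 - x * (x ^ 3) ^ i),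
    ← neg_one_mul, hneg, ← Finset.prod_mul_distrib, ← Finset.prod_mul_distrib]
  refine Finset.prod_congr rfl fun i hi => ?_
  have hi' : i < 2 * k + 1 := Finset.mem_range.mp hi
  have hone : x ^ (3 * (i + 1)) * (x * (x ^ 3) ^ (2 * k + 1 - 1 - i)) = 1 := by
    rw [← pow_mul, ← pow_succ', ← pow_add,
      show 3 * (i + 1) + (3 * (2 * k + 1 - 1 - i) + 1) = (3 * k + 2) * 2 by omega,
      pow_mul, hx, one_pow]
  rw [mul_sub, hone]
  ring

theorem cyclotomic_dvd_X_pow_mul_qPoch_add {R : Type*} [CommRing R] {n M : ℕ}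
    (hM : 3 * M + 1 = 2 * n) :
    Polynomial.cyclotomic n R ∣
      Polynomial.X ^ M * qPoch Polynomial.X (Polynomial.X ^ 3) M +
        qPoch (Polynomial.X ^ 3) (Polynomial.X ^ 3) M := by
  have hroot : AdjoinRoot.root (Polynomial.cyclotomic n R) ^ n = 1 := by
    have h := AdjoinRoot.mk_eq_zero.mpr (Polynomial.cyclotomic.dvd_X_pow_sub_one n R)
    simpa [sub_eq_zero] using h
  rw [← AdjoinRoot.mk_eq_zero, map_add, map_mul, qPoch_map, qPoch_map]
  simp only [map_pow, AdjoinRoot.mk_X]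
  rw [pow_mul_qPoch_eq_neg_qPoch_of_pow_eq_one hroot hM, neg_add_cancel]

theorem isCoprime_X_cyclotomic {R : Type*} [CommRing R] {n : ℕ} (hn : 0 < n) :
    IsCoprime (Polynomial.X : Polynomial R) (Polynomial.cyclotomic n R) := by
  refine IsCoprime.of_isCoprime_of_dvd_right ?_ (Polynomial.cyclotomic.dvd_X_pow_sub_one n R)
  refine ⟨Polynomial.X ^ (n - 1), -1, ?_⟩
  rw [← pow_succ, Nat.sub_add_cancel hn]
  ring

theorem stmt14 (n M : ℕ) (hn : 0 < n) (hmod : n % 3 = 2) (hM : M = (2 * n - 1) / 3) :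
    ratCongr
      (qPoch RatFunc.X (RatFunc.X ^ 3) M)
      (-(RatFunc.X ^ (-(M : ℤ))) * qPoch (RatFunc.X ^ 3) (RatFunc.X ^ 3) M)
      (Polynomial.cyclotomic n ℚ) := by
  obtain ⟨r, hr⟩ := cyclotomic_dvd_X_pow_mul_qPoch_add (R := ℚ) (n := n) (M := M) (by omega)
  refine ⟨r, Polynomial.X ^ M, pow_ne_zero _ Polynomial.X_ne_zero,
    (isCoprime_X_cyclotomic hn).pow_left.isRelPrime, ?_⟩
  have hX : (RatFunc.X : RatFunc ℚ) ^ M ≠ 0 := pow_ne_zero _ RatFunc.X_ne_zero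
  rw [← hr, map_add, map_mul, qPoch_map, qPoch_map]
  simp only [map_pow, RatFunc.algebraMap_X, zpow_neg, zpow_natCast]
  field_simp
  ring
end

section
/- Let p be a prime with p ≡ 1 (mod 3). Then, in the field ℤ/pℤ, Σ_{i=1}^{(p-1)/3} (3i−1)^{−2} = (2/9) · Σ_{i=1}^{(2p-2)/3} i^{−2}, where all the inverses are taken in ℤ/pℤ (each 3i−1 with 1 ≤ i ≤ (p−1)/3 and each i with 1 ≤ i ≤ (2p−2)/3 is nonzero modulo p, and 9 is invertible modulo p). -/
open Finset

theorem ZMod.sum_range_natCast {M : Type*} [AddCommMonoid M] (p : ℕ) [NeZero p]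
    (f : ZMod p → M) : ∑ i ∈ range p, f i = ∑ x, f x :=
  sum_nbij' (fun i => (i : ZMod p)) ZMod.val (by simp)
    (fun x _ => mem_range.2 (ZMod.val_lt x))
    (fun i hi => ZMod.val_cast_of_lt (mem_range.1 hi)) (by simp) (by simp)

/-- The inverse squares of all the residues modulo a prime `p > 3` sum to zero. -/
theorem ZMod.sum_range_inv_sq_eq_zero (p : ℕ) [Fact p.Prime] (hp : 3 < p) :
    ∑ i ∈ range p, ((i : ZMod p)⁻¹) ^ 2 = 0 := by
  rw [ZMod.sum_range_natCast p fun x => x⁻¹ ^ 2]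
  refine (Equiv.sum_comp (Equiv.inv (ZMod p)) fun x => x ^ 2).trans ?_
  exact FiniteField.sum_pow_lt_card_sub_one (ZMod p) 2 (by rw [ZMod.card]; omega)

theorem ZMod.natCast_ne_zero_of_pos_of_lt {p i : ℕ} (h0 : 0 < i) (hi : i < p) :
    (i : ZMod p) ≠ 0 := by
  rw [Ne, ZMod.natCast_eq_zero_iff]
  exact Nat.not_dvd_of_pos_of_lt h0 hi

theorem stmt15 (p : ℕ) (hp : p.Prime) (hmod : p % 3 = 1) :
    (∀ i ∈ Finset.Icc 1 ((p - 1) / 3), (3 * (i : ZMod p) - 1) ≠ 0) ∧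
    (∀ i ∈ Finset.Icc 1 ((2 * p - 2) / 3), (i : ZMod p) ≠ 0) ∧
    (9 : ZMod p) ≠ 0 ∧
    ∑ i ∈ Finset.Icc 1 ((p - 1) / 3), ((3 * (i : ZMod p) - 1)⁻¹) ^ 2
      = ((2 : ZMod p) * (9 : ZMod p)⁻¹) * ∑ i ∈ Finset.Icc 1 ((2 * p - 2) / 3), ((i : ZMod p)⁻¹) ^ 2 := by
  have : Fact p.Prime := ⟨hp⟩
  have hp2 := hp.two_le
  obtain ⟨n, hn⟩ : ∃ n, p = 3 * n + 1 := ⟨p / 3, by omega⟩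
  rw [show (p - 1) / 3 = n by omega, show (2 * p - 2) / 3 = n + n by omega]
  have hcast : (3 : ZMod p) * n + 1 = 0 := by
    have h : ((3 * n + 1 : ℕ) : ZMod p) = 0 := hn ▸ ZMod.natCast_self p
    exact_mod_cast h
  have h3 : (3 : ZMod p) ≠ 0 :=
    mod_cast ZMod.natCast_ne_zero_of_pos_of_lt (p := p) (i := 3) (by omega) (by omega)
  have h9 : (9 : ZMod p) ≠ 0 := by
    rw [show (9 : ZMod p) = 3 ^ 2 by norm_num]
    exact pow_ne_zero 2 h3
  have hshift (i : ℕ) : 3 * (i : ZMod p) - 1 = 3 * ((n + i : ℕ) : ZMod p) := by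
    push_cast
    linear_combination -hcast
  refine ⟨fun i hi => ?_, fun i hi => ?_, h9, ?_⟩
  · rw [mem_Icc] at hi
    rw [hshift]
    exact mul_ne_zero h3 (ZMod.natCast_ne_zero_of_pos_of_lt (by omega) (by omega))
  · rw [mem_Icc] at hi
    exact ZMod.natCast_ne_zero_of_pos_of_lt (by omega) (by omega)
  have hIcc (m : ℕ) (f : ℕ → ZMod p) : ∑ i ∈ Icc 1 m, f i = ∑ i ∈ range m, f (i + 1) := by
    rw [range_eq_Ico, sum_Ico_add' f 0 m 1]
    rfl
  have htotal := ZMod.sum_range_inv_sq_eq_zero p (by omega)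
  have hrefl : ∑ i ∈ range n, (((n + n + i + 1 : ℕ) : ZMod p)⁻¹) ^ 2
      = ∑ i ∈ range n, (((i + 1 : ℕ) : ZMod p)⁻¹) ^ 2 := by
    rw [← sum_range_reflect]
    refine sum_congr rfl fun i hi => ?_
    rw [mem_range] at hi
    have h : ((n + n + (n - 1 - i) + 1 : ℕ) : ZMod p) = -((i + 1 : ℕ) : ZMod p) := by
      rw [eq_neg_iff_add_eq_zero, ← Nat.cast_add,
        show n + n + (n - 1 - i) + 1 + (i + 1) = p by omega, ZMod.natCast_self]
    rw [h, inv_neg, neg_sq]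
  rw [show range p = range (n + n + n + 1) by rw [hn]; congr 1; ring, sum_range_succ',
    sum_range_add, sum_range_add, hrefl] at htotal
  simp only [Nat.cast_zero, inv_zero, ne_eq, OfNat.ofNat_ne_zero, not_false_eq_true, zero_pow,
    add_zero] at htotal
  have hleft : ∑ i ∈ range n, ((3 * ((i + 1 : ℕ) : ZMod p) - 1)⁻¹) ^ 2
      = (9 : ZMod p)⁻¹ * ∑ i ∈ range n, (((n + i + 1 : ℕ) : ZMod p)⁻¹) ^ 2 := by
    rw [mul_sum]
    refine sum_congr rfl fun i _ => ?_
    rw [hshift, mul_inv, mul_pow, ← add_assoc, inv_pow 3, show (3 : ZMod p) ^ 2 = 9 by norm_num]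
  rw [hIcc, hIcc, hleft, sum_range_add]
  linear_combination -(9 : ZMod p)⁻¹ * htotal
end

section
/- Let d ≥ 2 and n be positive integers with n ≡ 1 (mod d), set m = (n−1)/d, and let q be a complex number such that (q;q^d)_m ≠ 0, (q^3;q^d)_m ≠ 0, q ≠ 1, and 1 − q^{di−d+2} ≠ 0 for all 1 ≤ i ≤ m. Then the limit as the complex number a tends to 1 of ((1−aq^n)(a−q^n)/(1−a)^2) · { ((q^2;q^d)_m (q^2;q^d)_m) / ((q;q^d)_m (q^3;q^d)_m) − ((aq^2;q^d)_m (q^2/a;q^d)_m) / ((q;q^d)_m (q^3;q^d)_m) } equals [n]^2 · ((q^2;q^d)_m^2 / ((q;q^d)_m (q^3;q^d)_m)) · Σ_{i=1}^{m} q^{di-d+2} / [di-d+2]^2, where [m] = (1−q^m)/(1−q). -/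
open Finset Filter

/-- The `q`-integer `[m] = (1-q^m)/(1-q)` at a complex number `q`. -/
noncomputable def qintC (q : ℂ) (m : ℕ) : ℂ := (1 - q ^ m) / (1 - q)

theorem hasDerivAt_prod_sub_mul_zero {ι : Type*} (s : Finset ι) (u v : ι → ℂ)
    (hu : ∀ i ∈ s, u i ≠ 0) :
    HasDerivAt (fun t : ℂ => ∏ i ∈ s, (u i - v i * t))
      (-((∏ i ∈ s, u i) * ∑ i ∈ s, v i / u i)) 0 := by
  classical
  have h := HasDerivAt.fun_finsetProd (u := s) (f := fun i (t : ℂ) => u i - v i * t)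
    (f' := fun i => -v i) (x := 0)
    fun i _ => by simpa using ((hasDerivAt_id (0 : ℂ)).const_mul (v i)).const_sub (u i)
  refine h.congr_deriv ?_
  rw [Finset.mul_sum, ← Finset.sum_neg_distrib]
  refine Finset.sum_congr rfl fun i hi => ?_
  have hui := hu i hi
  rw [← Finset.prod_erase_mul s u hi]
  simp only [mul_zero, sub_zero, smul_eq_mul]
  field_simp

theorem qPoch_mul_qPoch_div {a : ℂ} (ha : a ≠ 0) (x p : ℂ) (m : ℕ) :
    qPoch (a * x) p m * qPoch (x / a) p m =
      ∏ i ∈ Finset.range m, ((1 - x * p ^ i) ^ 2 - x * p ^ i * ((1 - a) ^ 2 / a)) := by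
  rw [qPoch, qPoch, ← Finset.prod_mul_distrib]
  refine Finset.prod_congr rfl fun i _ => ?_
  field_simp
  ring

theorem tendsto_qPoch_sq_sub_div (x p : ℂ) (m : ℕ)
    (hx : ∀ i ∈ Finset.range m, 1 - x * p ^ i ≠ 0) :
    Tendsto
      (fun a : ℂ =>
        (qPoch x p m ^ 2 - qPoch (a * x) p m * qPoch (x / a) p m) / (1 - a) ^ 2)
      (nhdsWithin 1 {(1 : ℂ)}ᶜ)
      (nhds (qPoch x p m ^ 2 *
        ∑ i ∈ Finset.range m, x * p ^ i / (1 - x * p ^ i) ^ 2)) := by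
  have hD := hasDerivAt_prod_sub_mul_zero (Finset.range m) (fun i => (1 - x * p ^ i) ^ 2)
    (fun i => x * p ^ i) fun i hi => pow_ne_zero 2 (hx i hi)
  rw [hasDerivAt_iff_tendsto_slope] at hD
  have h_inv : Tendsto (fun a : ℂ => a⁻¹) (nhdsWithin 1 {(1 : ℂ)}ᶜ) (nhds 1) := by
    simpa using (tendsto_inv₀ (one_ne_zero (α := ℂ))).mono_left nhdsWithin_le_nhds
  have ha0 : ∀ᶠ a : ℂ in nhdsWithin 1 {(1 : ℂ)}ᶜ, a ≠ 0 :=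
    nhdsWithin_le_nhds (eventually_ne_nhds one_ne_zero)
  have ha1 : ∀ᶠ a : ℂ in nhdsWithin 1 {(1 : ℂ)}ᶜ, a ≠ 1 := self_mem_nhdsWithin
  have ht : Tendsto (fun a : ℂ => (1 - a) ^ 2 / a) (nhdsWithin 1 {(1 : ℂ)}ᶜ)
      (nhdsWithin 0 {(0 : ℂ)}ᶜ) := by
    refine tendsto_nhdsWithin_iff.2 ⟨?_, ?_⟩
    · have hc : Tendsto (fun a : ℂ => (1 - a) ^ 2) (nhdsWithin 1 {(1 : ℂ)}ᶜ) (nhds 0) := by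
        have : Continuous fun a : ℂ => (1 - a) ^ 2 := by fun_prop
        simpa using (this.tendsto 1).mono_left nhdsWithin_le_nhds
      simpa [div_eq_mul_inv] using hc.mul h_inv
    · filter_upwards [ha0, ha1] with a h0 h1
      exact div_ne_zero (pow_ne_zero 2 (sub_ne_zero.2 h1.symm)) h0
  have h := (h_inv.mul (hD.comp ht)).neg
  simp only [one_mul, neg_neg, Finset.prod_pow] at h
  refine h.congr' ?_
  filter_upwards [ha0, ha1] with a h0 h1
  have h1' : 1 - a ≠ 0 := sub_ne_zero.2 h1.symm
  rw [qPoch_mul_qPoch_div h0]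
  simp only [Function.comp_apply, slope_def_field, mul_zero, sub_zero, Finset.prod_pow, qPoch]
  field_simp
  ring_nf

theorem stmt16 (d n m : ℕ) (hd : 2 ≤ d) (hn : 0 < n) (hmod : n % d = 1)
    (hm : m = (n - 1) / d) (q : ℂ)
    (h1 : qPoch q (q ^ d) m ≠ 0) (h3 : qPoch (q ^ 3) (q ^ d) m ≠ 0) (hq : q ≠ 1)
    (hqi : ∀ i ∈ Finset.Icc 1 m, 1 - q ^ (d * i - d + 2) ≠ 0) :
    Filter.Tendsto
      (fun a : ℂ =>
        (1 - a * q ^ n) * (a - q ^ n) / (1 - a) ^ 2 *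
          ((qPoch (q ^ 2) (q ^ d) m * qPoch (q ^ 2) (q ^ d) m) /
              (qPoch q (q ^ d) m * qPoch (q ^ 3) (q ^ d) m) -
            (qPoch (a * q ^ 2) (q ^ d) m * qPoch (q ^ 2 / a) (q ^ d) m) /
              (qPoch q (q ^ d) m * qPoch (q ^ 3) (q ^ d) m)))
      (nhdsWithin 1 {(1 : ℂ)}ᶜ)
      (nhds (qintC q n ^ 2 *
        (qPoch (q ^ 2) (q ^ d) m ^ 2 /
          (qPoch q (q ^ d) m * qPoch (q ^ 3) (q ^ d) m)) *
        ∑ i ∈ Finset.Icc 1 m, q ^ (d * i - d + 2) / qintC q (d * i - d + 2) ^ 2)) := by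
  have hexp : ∀ i : ℕ, q ^ 2 * (q ^ d) ^ i = q ^ (d * (i + 1) - d + 2) := fun i => by
    rw [mul_add_one, Nat.add_sub_cancel, ← pow_mul, ← pow_add, add_comm]
  have hx : ∀ i ∈ Finset.range m, 1 - q ^ 2 * (q ^ d) ^ i ≠ 0 := fun i hi => by
    rw [hexp]
    exact hqi (i + 1) (Finset.mem_Icc.2 ⟨by omega, Finset.mem_range.1 hi⟩)
  have hsum : ∑ i ∈ Finset.Icc 1 m, q ^ (d * i - d + 2) / qintC q (d * i - d + 2) ^ 2 =
      (1 - q) ^ 2 *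
        ∑ i ∈ Finset.range m, q ^ 2 * (q ^ d) ^ i / (1 - q ^ 2 * (q ^ d) ^ i) ^ 2 := by
    rw [← Finset.Ico_add_one_right_eq_Icc, Finset.sum_Ico_eq_sum_range, Finset.mul_sum,
      Nat.add_sub_cancel]
    refine Finset.sum_congr rfl fun i _ => ?_
    rw [hexp, add_comm 1 i, qintC, div_pow, div_div_eq_mul_div]
    ring
  have hpre : Tendsto (fun a : ℂ => (1 - a * q ^ n) * (a - q ^ n))
      (nhdsWithin 1 {(1 : ℂ)}ᶜ) (nhds ((1 - q ^ n) ^ 2)) := by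
    have hc : Continuous fun a : ℂ => (1 - a * q ^ n) * (a - q ^ n) := by fun_prop
    simpa [sq] using (hc.tendsto 1).mono_left nhdsWithin_le_nhds
  have h := (hpre.mul (tendsto_qPoch_sq_sub_div (q ^ 2) (q ^ d) m hx)).div_const
    (qPoch q (q ^ d) m * qPoch (q ^ 3) (q ^ d) m)
  convert h using 1
  · funext a
    ring
  · have hq' : 1 - q ≠ 0 := sub_ne_zero.2 hq.symm
    rw [hsum, qintC]
    field_simp
end
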